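/- The superposition map used in the D^{(1)}_n vertex operator construction is a bijection: for a fixed integer l ≥ 0, the map sending a pair ((x_1, x_2), (y_1, y_2)) of elements of {(u,v) ∈ (ℤ_{≥0})^2 : u + v = l} to (z_1, z_2, z_3, z_4) = (min(x_1, y_1), max(0, y_1 − x_1), max(0, y_2 − x_2), min(x_2, y_2)) is well defined into, and bijective onto, the set {(z_1, z_2, z_3, z_4) ∈ (ℤ_{≥0})^4 : z_1 + z_2 + z_3 + z_4 = l and z_2 · z_3 = 0}; in particular the image always satisfies z_2 z_3 = 0 and z_1 + z_2 + z_3 + z_4 = l, and under these conditions the map is invertible. -/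

import Mathlib

/-- the superposition map used in the `D^{(1)}_n` vertex operator
construction is well defined into, and bijective onto, the set
`{(z₁,z₂,z₃,z₄) : z₁+z₂+z₃+z₄ = l, z₂·z₃ = 0}`.  Here truncated subtraction on
`ℕ` realizes `max(0, y₁ − x₁)` and `max(0, y₂ − x₂)`. -/
theorem superposition_bijective (l : ℕ) :
    Set.BijOn
      (fun p : (ℕ × ℕ) × (ℕ × ℕ) =>
        (min p.1.1 p.2.1, p.2.1 - p.1.1, p.2.2 - p.1.2, min p.1.2 p.2.2))
      {p : (ℕ × ℕ) × (ℕ × ℕ) | p.1.1 + p.1.2 = l ∧ p.2.1 + p.2.2 = l}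
      {z : ℕ × ℕ × ℕ × ℕ |
        z.1 + z.2.1 + z.2.2.1 + z.2.2.2 = l ∧ z.2.1 * z.2.2.1 = 0} := by
  refine ⟨?_, ?_, ?_⟩
  · rintro ⟨⟨x₁, x₂⟩, ⟨y₁, y₂⟩⟩ h
    simp only [Set.mem_ofPred_eq, mul_eq_zero] at h ⊢
    omega
  · rintro ⟨⟨x₁, x₂⟩, ⟨y₁, y₂⟩⟩ h ⟨⟨x₁', x₂'⟩, ⟨y₁', y₂'⟩⟩ h' heq
    simp only [Set.mem_ofPred_eq, Prod.mk.injEq] at h h' heq ⊢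
    omega
  · rintro ⟨z₁, z₂, z₃, z₄⟩ h
    refine ⟨((z₁ + z₃, z₂ + z₄), (z₁ + z₂, z₃ + z₄)), ?_, ?_⟩ <;>
      simp only [Set.mem_ofPred_eq, Prod.mk.injEq, mul_eq_zero] at h ⊢ <;> omega
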